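/- Let (X,d,μ) be a complete doubling metric measure space, let X_α ⊆ X be measurable with μ(X_α) > 0, and let x^1,…,x^N be bounded Lipschitz functions on X_α forming a differentiable chart: for every bounded Lipschitz function f on X_α there exist unique (up to μ-null sets) measurable μ-essentially bounded functions ∂_1 f,…,∂_N f : X_α → ℝ with Lip(f − Σ_{j=1}^N ∂_j f(z)·x^j)(z) = 0 for μ-a.e. z ∈ X_α; assume moreover that each map ∂_j : f ↦ ∂_j f is a derivation on (X_α,d,μ|_{X_α}). Let G be a set of bounded Lipschitz functions on X_α that sequentially generates the bounded Lipschitz functions on X_α. Then for every measurable U ⊆ X_α with μ(U) > 0 there exist a measurable V ⊆ U with μ(V) > 0 and functions g'_1,…,g'_N ∈ G that are independent at μ-a.e. point of V: for μ-a.e. z ∈ V, if c_1,…,c_N ∈ ℝ satisfy Lip(Σ_{j=1}^N c_j g'_j)(z) = 0 then c_1 = ⋯ = c_N = 0. -/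

import Mathlib

open MeasureTheory Metric Filter Set Topology
open scoped ENNReal NNReal

noncomputable section

/-- `f` is a bounded Lipschitz function. -/
def IsBddLipschitz {X : Type*} [PseudoMetricSpace X] (f : X → ℝ) : Prop :=
  (∃ K : ℝ≥0, LipschitzWith K f) ∧ ∃ M : ℝ, ∀ x, |f x| ≤ M

/-- The global Lipschitz constant of `f`. -/
def glip {X : Type*} [PseudoMetricSpace X] (f : X → ℝ) : ℝ :=
  sInf {K : ℝ | 0 ≤ K ∧ ∀ x y, |f x - f y| ≤ K * dist x y}

/-- `max (sup_X |f|) (global Lipschitz constant of f)`. -/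
def lipNorm {X : Type*} [PseudoMetricSpace X] (f : X → ℝ) : ℝ :=
  max (⨆ x, |f x|) (glip f)

/-- The variation of `f` on the open ball `B(x,r)`:
`varlip f x r = r⁻¹ · sup_{y ∈ B(x,r)} |f x - f y|`. -/
def varlip {X : Type*} [PseudoMetricSpace X] (f : X → ℝ) (x : X) (r : ℝ) : ℝ :=
  r⁻¹ * sSup ((fun y => |f x - f y|) '' ball x r)

/-- The upper variation of `f` at `x` from scale `r` down to `0`:
`Lip f (x,r) = sup_{0 < s ≤ r} varlip f x s`. -/
def bigLipR {X : Type*} [PseudoMetricSpace X] (f : X → ℝ) (x : X) (r : ℝ) : ℝ :=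
  ⨆ s : Ioc (0:ℝ) r, varlip f x s.1

/-- The lower variation of `f` at `x` from scale `r` down to `0`:
`lip f (x,r) = inf_{0 < s ≤ r} varlip f x s`. -/
def smlLipR {X : Type*} [PseudoMetricSpace X] (f : X → ℝ) (x : X) (r : ℝ) : ℝ :=
  ⨅ s : Ioc (0:ℝ) r, varlip f x s.1

/-- The pointwise upper Lipschitz constant
`Lip f (x) = inf_{r>0} sup_{0<s≤r} varlip f x s`. -/
def bigLip {X : Type*} [PseudoMetricSpace X] (f : X → ℝ) (x : X) : ℝ :=
  ⨅ r : Ioi (0:ℝ), bigLipR f x r.1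

/-- The pointwise lower Lipschitz constant
`lip f (x) = sup_{r>0} inf_{0<s≤r} varlip f x s`. -/
def smlLip {X : Type*} [PseudoMetricSpace X] (f : X → ℝ) (x : X) : ℝ :=
  ⨆ r : Ioi (0:ℝ), smlLipR f x r.1

/-- A derivation on the metric measure space `(X,d,μ)`: a linear, bounded operator
from bounded Lipschitz functions to measurable essentially bounded functions that
satisfies the Leibniz rule and is weak* sequentially continuous. -/
structure MDerivation (X : Type*) [PseudoMetricSpace X] [MeasurableSpace X]
    (μ : MeasureTheory.Measure X) where
  D : (X → ℝ) → (X → ℝ)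
  C : ℝ
  C_nonneg : 0 ≤ C
  measurable_D : ∀ f, IsBddLipschitz f → Measurable (D f)
  linear : ∀ (a b : ℝ) (f g : X → ℝ), IsBddLipschitz f → IsBddLipschitz g →
      ∀ᵐ x ∂μ, D (fun y => a * f y + b * g y) x = a * D f x + b * D g x
  bound : ∀ f, IsBddLipschitz f → ∀ᵐ x ∂μ, |D f x| ≤ C * lipNorm f
  leibniz : ∀ f g, IsBddLipschitz f → IsBddLipschitz g →
      ∀ᵐ x ∂μ, D (fun y => f y * g y) x = f x * D g x + g x * D f x
  weakStar : ∀ (F : ℕ → X → ℝ) (f : X → ℝ), (∀ n, IsBddLipschitz (F n)) →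
      IsBddLipschitz f → (∃ B : ℝ, ∀ n, lipNorm (F n) ≤ B) →
      (∀ x, Tendsto (fun n => F n x) atTop (𝓝 (f x))) →
      ∀ g : X → ℝ, Integrable g μ →
        Tendsto (fun n => ∫ x, D (F n) x * g x ∂μ) atTop (𝓝 (∫ x, D f x * g x ∂μ))

/-- The restriction of `μ` to a subset `s`, as a measure on the subtype `s`. -/
def subMeasure {X : Type*} [MeasurableSpace X] (μ : MeasureTheory.Measure X) (s : Set X) :
    MeasureTheory.Measure s :=
  MeasureTheory.Measure.comap Subtype.val μ

/-- `G` sequentially generates the bounded Lipschitz functions: every bounded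
Lipschitz function is the pointwise limit of a sequence, with uniformly bounded
Lipschitz norms, from the unital `ℝ`-subalgebra generated by `G`. -/
def SeqGenerates {X : Type*} [PseudoMetricSpace X] (G : Set (X → ℝ)) : Prop :=
  ∀ f : X → ℝ, IsBddLipschitz f → ∃ p : ℕ → X → ℝ,
    (∀ k, p k ∈ Algebra.adjoin ℝ G) ∧ (∃ B : ℝ, ∀ k, lipNorm (p k) ≤ B) ∧
    ∀ x, Tendsto (fun k => p k x) atTop (𝓝 (f x))

/-! ### Pointwise Lipschitz constants -/

section Slope

variable {Z : Type*} [PseudoMetricSpace Z]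

theorem varlip_nonneg (f : Z → ℝ) (z : Z) {s : ℝ} (hs : 0 < s) :
    0 ≤ varlip f z s := by
  refine mul_nonneg (inv_nonneg.2 hs.le) (Real.sSup_nonneg ?_)
  rintro _ ⟨y, -, rfl⟩
  exact abs_nonneg _

theorem varlip_le_of_forall {f : Z → ℝ} {z : Z} {s C : ℝ} (hs : 0 < s)
    (h : ∀ y ∈ ball z s, |f z - f y| ≤ C * s) : varlip f z s ≤ C := by
  have : sSup ((fun y => |f z - f y|) '' ball z s) ≤ C * s := by
    refine csSup_le ⟨_, mem_image_of_mem _ (mem_ball_self hs)⟩ ?_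
    rintro _ ⟨y, hy, rfl⟩
    exact h y hy
  unfold varlip
  rw [inv_mul_le_iff₀ hs]
  linarith

theorem LipschitzWith.abs_sub_le {f : Z → ℝ} {K : ℝ≥0} (hf : LipschitzWith K f) (y z : Z) :
    |f y - f z| ≤ K * dist y z := by
  simpa [Real.dist_eq] using hf.dist_le_mul y z

theorem LipschitzWith.varlip_le {f : Z → ℝ} {K : ℝ≥0} (hf : LipschitzWith K f) (z : Z) {s : ℝ}
    (hs : 0 < s) : varlip f z s ≤ K := by
  refine varlip_le_of_forall hs fun y hy => (hf.abs_sub_le z y).trans ?_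
  rw [mem_ball, dist_comm] at hy
  gcongr

theorem LipschitzWith.bddAbove_varlip {f : Z → ℝ} {K : ℝ≥0} (hf : LipschitzWith K f) (z : Z)
    (r : ℝ) : BddAbove (range fun s : Ioc (0 : ℝ) r => varlip f z s.1) :=
  ⟨K, by rintro _ ⟨s, rfl⟩; exact hf.varlip_le z s.2.1⟩

theorem bigLipR_nonneg (f : Z → ℝ) (z : Z) (r : ℝ) : 0 ≤ bigLipR f z r :=
  Real.iSup_nonneg fun s => varlip_nonneg f z s.2.1

/-- For a Lipschitz function, the pointwise upper Lipschitz constant vanishes exactly when the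
increments are negligible with respect to the distance. -/
theorem LipschitzWith.bigLip_eq_zero_iff {f : Z → ℝ} {K : ℝ≥0} (hf : LipschitzWith K f) (z : Z) :
    bigLip f z = 0 ↔ (fun y => f y - f z) =o[𝓝 z] fun y => dist y z := by
  have hbdd : BddBelow (range fun r : Ioi (0 : ℝ) => bigLipR f z r.1) :=
    ⟨0, by rintro _ ⟨r, rfl⟩; exact bigLipR_nonneg f z r⟩
  rw [Asymptotics.isLittleO_iff]
  constructor
  · intro h ε hε
    have : Nonempty (Ioi (0 : ℝ)) := ⟨⟨1, mem_Ioi.2 one_pos⟩⟩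
    obtain ⟨⟨r, hr⟩, hlt⟩ := exists_lt_of_ciInf_lt (show (⨅ r : Ioi (0 : ℝ), bigLipR f z r.1)
      < ε / 2 from h.trans_lt (half_pos hε))
    have hr : 0 < r := hr
    filter_upwards [ball_mem_nhds z (half_pos hr)] with y hy
    rw [mem_ball] at hy
    rw [Real.norm_eq_abs, Real.norm_of_nonneg dist_nonneg]
    rcases (dist_nonneg (x := y) (y := z)).eq_or_lt with h0 | h0
    · have := hf.abs_sub_le y z
      rw [← h0] at this ⊢
      simpa using this
    · set s := 2 * dist y z with hs
      have hspos : 0 < s := by positivity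
      have h1 : varlip f z s ≤ bigLipR f z r :=
        le_ciSup (hf.bddAbove_varlip z r) ⟨s, hspos, by linarith⟩
      have h2 : |f z - f y| ≤ sSup ((fun y => |f z - f y|) '' ball z s) := by
        refine le_csSup ⟨K * s, ?_⟩ (mem_image_of_mem _ (by rw [mem_ball]; linarith))
        rintro _ ⟨y, hy, rfl⟩
        rw [mem_ball, dist_comm] at hy
        exact (hf.abs_sub_le z y).trans (by gcongr)
      have h3 : sSup ((fun y => |f z - f y|) '' ball z s) < s * (ε / 2) :=
        (inv_mul_lt_iff₀ hspos).1 (h1.trans_lt hlt)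
      rw [abs_sub_comm]
      linarith
  · intro h
    refine le_antisymm (le_of_forall_pos_le_add fun ε hε => ?_)
      (Real.iInf_nonneg fun r => bigLipR_nonneg f z r)
    obtain ⟨r, hr, hball⟩ := Metric.eventually_nhds_iff_ball.1 (h hε)
    have : Nonempty (Ioc (0 : ℝ) r) := ⟨⟨r, hr, le_rfl⟩⟩
    rw [zero_add]
    refine (ciInf_le hbdd ⟨r, hr⟩).trans (ciSup_le fun s => varlip_le_of_forall s.2.1 fun y hy => ?_)
    have := hball y (ball_subset_ball s.2.2 hy)
    rw [Real.norm_eq_abs, Real.norm_of_nonneg dist_nonneg, abs_sub_comm] at this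
    rw [mem_ball] at hy
    exact this.trans (by gcongr)

/-- The asymptotic Lipschitz constant of `f` at `z`, as the infimum of the constants that bound
the increments of `f` near `z`. -/
def localSlope (f : Z → ℝ) (z : Z) : ℝ :=
  sInf {t | 0 ≤ t ∧ ∀ᶠ y in 𝓝 z, |f y - f z| ≤ t * dist y z}

theorem localSlope_nonneg (f : Z → ℝ) (z : Z) : 0 ≤ localSlope f z :=
  Real.sInf_nonneg fun _ ht => ht.1

theorem localSlope_le {f : Z → ℝ} {z : Z} {t : ℝ} (ht : 0 ≤ t)
    (h : ∀ᶠ y in 𝓝 z, |f y - f z| ≤ t * dist y z) : localSlope f z ≤ t :=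
  csInf_le ⟨0, fun _ hs => hs.1⟩ ⟨ht, h⟩

theorem LipschitzWith.localSlope_lt_iff {f : Z → ℝ} {K : ℝ≥0} (hf : LipschitzWith K f) {z : Z}
    {a : ℝ} : localSlope f z < a ↔
      ∃ t, 0 ≤ t ∧ t < a ∧ ∀ᶠ y in 𝓝 z, |f y - f z| ≤ t * dist y z := by
  constructor
  · intro h
    have hne : {t | 0 ≤ t ∧ ∀ᶠ y in 𝓝 z, |f y - f z| ≤ t * dist y z}.Nonempty :=
      ⟨(K : ℝ), K.2, Eventually.of_forall fun y => hf.abs_sub_le y z⟩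
    obtain ⟨t, ⟨h0, ht⟩, hta⟩ := exists_lt_of_csInf_lt hne h
    exact ⟨t, h0, hta, ht⟩
  · rintro ⟨t, h0, hta, ht⟩
    exact (localSlope_le h0 ht).trans_lt hta

theorem LipschitzWith.localSlope_eq_zero_iff {f : Z → ℝ} {K : ℝ≥0} (hf : LipschitzWith K f)
    (z : Z) : localSlope f z = 0 ↔ (fun y => f y - f z) =o[𝓝 z] fun y => dist y z := by
  rw [Asymptotics.isLittleO_iff]
  simp only [Real.norm_eq_abs, abs_dist]
  constructor
  · intro h ε hε
    obtain ⟨t, -, hta, ht⟩ := hf.localSlope_lt_iff.1 (h ▸ hε : localSlope f z < ε)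
    filter_upwards [ht] with y hy
    exact hy.trans (by gcongr)
  · intro h
    refine le_antisymm (le_of_forall_pos_le_add fun ε hε => ?_) (localSlope_nonneg f z)
    rw [zero_add]
    exact localSlope_le hε.le (h hε)

theorem LipschitzWith.measurable_localSlope [MeasurableSpace Z] [OpensMeasurableSpace Z]
    {f : Z → ℝ} {K : ℝ≥0} (hf : LipschitzWith K f) : Measurable (localSlope f) := by
  refine measurable_of_Iio fun a => ?_
  have key : localSlope f ⁻¹' Iio a = ⋃ q : ℚ, ⋃ n : ℕ, {z | (0 ≤ (q : ℝ) ∧ (q : ℝ) < a) ∧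
      ∀ y, dist y z < 1 / ((n : ℝ) + 1) → |f y - f z| ≤ q * dist y z} := by
    ext z
    simp only [mem_preimage, mem_Iio, hf.localSlope_lt_iff, mem_iUnion, mem_ofPred_eq]
    constructor
    · rintro ⟨t, h0, hta, ht⟩
      obtain ⟨q, htq, hqa⟩ := exists_rat_btwn hta
      obtain ⟨r, hr, hball⟩ := Metric.eventually_nhds_iff_ball.1 ht
      obtain ⟨n, hn⟩ := exists_nat_one_div_lt hr
      exact ⟨q, n, ⟨h0.trans htq.le, hqa⟩, fun y hy =>
        (hball y (mem_ball.2 (hy.trans hn))).trans (by gcongr)⟩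
    · rintro ⟨q, n, ⟨h0, hqa⟩, h⟩
      refine ⟨q, h0, hqa, ?_⟩
      filter_upwards [ball_mem_nhds z (Nat.one_div_pos_of_nat (α := ℝ) (n := n))] with y hy
      exact h y hy
  rw [key]
  refine MeasurableSet.iUnion fun q => MeasurableSet.iUnion fun n => ?_
  rw [ofPred_and]
  refine (MeasurableSet.const _).inter (IsClosed.measurableSet ?_)
  rw [← isOpen_compl_iff]
  have : {z | ∀ y, dist y z < 1 / ((n : ℝ) + 1) → |f y - f z| ≤ q * dist y z}ᶜ =
      ⋃ y, {z | dist y z < 1 / ((n : ℝ) + 1) ∧ q * dist y z < |f y - f z|} := by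
    ext z
    simp
  rw [this]
  simp_rw [ofPred_and]
  have hc := hf.continuous
  exact isOpen_iUnion fun y => (isOpen_lt (by fun_prop) (by fun_prop)).inter
    (isOpen_lt (by fun_prop) (by fun_prop))

theorem LipschitzWith.localSlope_le_add {f g : Z → ℝ} {K : ℝ≥0}
    (hg : LipschitzWith K g) {C : ℝ} (hC : 0 ≤ C)
    (h : ∀ y z, |(f y - f z) - (g y - g z)| ≤ C * dist y z) (z : Z) :
    localSlope f z ≤ localSlope g z + C := by
  refine le_of_forall_pos_lt_add fun ε hε => ?_
  obtain ⟨t, h0, hta, ht⟩ := hg.localSlope_lt_iff.1 (lt_add_of_pos_right (localSlope g z) hε)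
  refine (localSlope_le (t := t + C) (by positivity) ?_).trans_lt (by linarith)
  filter_upwards [ht] with y hy
  have h1 := h y z
  have h2 : |f y - f z| ≤ |(f y - f z) - (g y - g z)| + |g y - g z| := by
    simpa using abs_add_le ((f y - f z) - (g y - g z)) (g y - g z)
  linarith

end Slope

/-! ### Measurable selection of zeros -/

section Selection

variable {Z C : Type*} [MeasurableSpace Z]

/-- The points at which a nonnegative Carathéodory function has a zero in a compact set form a
measurable set. -/
theorem measurableSet_exists_zero [PseudoMetricSpace C] {φ : Z → C → ℝ}
    (hnn : ∀ z c, 0 ≤ φ z c) (hm : ∀ c, Measurable fun z => φ z c)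
    (hc : ∀ z, Continuous (φ z)) {S : Set C} (hS : IsCompact S) :
    MeasurableSet {z | ∃ c ∈ S, φ z c = 0} := by
  obtain ⟨D, hDS, hD, hSD⟩ := hS.isSeparable.exists_countable_dense_subset
  have key : {z | ∃ c ∈ S, φ z c = 0} = ⋂ n : ℕ, ⋃ q ∈ D, {z | φ z q < 1 / ((n : ℝ) + 1)} := by
    ext z
    simp only [mem_ofPred_eq, mem_iInter, mem_iUnion, exists_prop]
    constructor
    · rintro ⟨c, hcS, h0⟩ n
      have hopen : IsOpen {q | φ z q < 1 / ((n : ℝ) + 1)} := isOpen_lt (hc z) continuous_const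
      obtain ⟨q, hq, hqD⟩ := mem_closure_iff.1 (hSD hcS) _ hopen
        (by rw [mem_ofPred_eq, h0]; exact Nat.one_div_pos_of_nat)
      exact ⟨q, hqD, hq⟩
    · intro h
      obtain ⟨q₀, hq₀, -⟩ := h 0
      obtain ⟨c, hcS, hmin⟩ := hS.exists_isMinOn ⟨q₀, hDS hq₀⟩ (hc z).continuousOn
      refine ⟨c, hcS, le_antisymm (le_of_forall_pos_le_add fun ε hε => ?_) (hnn z c)⟩
      obtain ⟨n, hn⟩ := exists_nat_one_div_lt hε
      obtain ⟨q, hq, hlt⟩ := h n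
      have := isMinOn_iff.1 hmin q (hDS hq)
      linarith
  rw [key]
  exact MeasurableSet.iInter fun n => MeasurableSet.biUnion hD fun q _ =>
    measurableSet_lt (hm q) measurable_const

/-- A nonnegative Carathéodory function with a zero in a compact set at every point has a
measurable selection of zeros: take the lexicographically smallest one. -/
theorem exists_measurable_zero {ι : Type*} [Fintype ι] {φ : Z → (ι → ℝ) → ℝ}
    (hnn : ∀ z c, 0 ≤ φ z c) (hm : ∀ c, Measurable fun z => φ z c)
    (hc : ∀ z, Continuous (φ z)) {S : Set (ι → ℝ)} (hS : IsCompact S)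
    (hex : ∀ z, ∃ c ∈ S, φ z c = 0) :
    ∃ h : Z → ι → ℝ, Measurable h ∧ ∀ z, h z ∈ S ∧ φ z (h z) = 0 := by
  classical
  have main : ∀ T : Finset ι, ∃ (ψ : Z → (ι → ℝ) → ℝ) (h : ι → Z → ℝ),
      (∀ z c, 0 ≤ ψ z c) ∧ (∀ c, Measurable fun z => ψ z c) ∧ (∀ z, Continuous (ψ z)) ∧
      (∀ z, ∃ c ∈ S, ψ z c = 0) ∧ (∀ z c, ψ z c = 0 → φ z c = 0) ∧
      ∀ i ∈ T, Measurable (h i) ∧ ∀ z c, ψ z c = 0 → c i = h i z := by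
    intro T
    induction T using Finset.induction_on with
    | empty => exact ⟨φ, 0, hnn, hm, hc, hex, fun _ _ h => h, by simp⟩
    | insert i T hi ih =>
      obtain ⟨ψ, h, hnn', hm', hc', hex', himp, hT⟩ := ih
      have hmin : ∀ z, ∃ c, (c ∈ S ∧ ψ z c = 0) ∧ ∀ c', c' ∈ S ∧ ψ z c' = 0 → c i ≤ c' i := by
        intro z
        have hcomp : IsCompact (S ∩ {c | ψ z c = 0}) :=
          hS.inter_right (isClosed_eq (hc' z) continuous_const)
        obtain ⟨c, hcS, hcm⟩ := hcomp.exists_isMinOn (hex' z)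
          (continuous_apply i).continuousOn
        exact ⟨c, hcS, fun c' hc' => isMinOn_iff.1 hcm c' hc'⟩
      choose m hm0 hmle using hmin
      have hmeas : Measurable fun z => m z i := by
        refine measurable_of_Iic fun t => ?_
        have : (fun z => m z i) ⁻¹' Iic t = {z | ∃ c ∈ S ∩ {c | c i ≤ t}, ψ z c = 0} := by
          ext z
          constructor
          · intro hz
            exact ⟨m z, ⟨(hm0 z).1, hz⟩, (hm0 z).2⟩
          · rintro ⟨c, ⟨hcS, hct⟩, h0⟩
            exact (hmle z c ⟨hcS, h0⟩).trans hct
        rw [this]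
        exact measurableSet_exists_zero hnn' hm' hc'
          (hS.inter_right (isClosed_le (continuous_apply i) continuous_const))
      have hzero : ∀ z c, ψ z c + |c i - m z i| = 0 → ψ z c = 0 ∧ c i = m z i := by
        intro z c h0
        have h1 := hnn' z c
        have h2 := abs_nonneg (c i - m z i)
        exact ⟨by linarith, sub_eq_zero.1 (abs_eq_zero.1 (by linarith))⟩
      refine ⟨fun z c => ψ z c + |c i - m z i|, Function.update h i fun z => m z i,
        fun z c => add_nonneg (hnn' z c) (abs_nonneg _), fun c => ?_, fun z => ?_,
        fun z => ⟨m z, (hm0 z).1, by simp [(hm0 z).2]⟩,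
        fun z c h0 => himp z c (hzero z c h0).1, fun j hj => ?_⟩
      · exact (hm' c).add (measurable_const.sub hmeas).abs
      · have := hc' z
        fun_prop
      · by_cases hji : j = i
        · subst hji
          simpa using ⟨hmeas, fun z c h0 => (hzero z c h0).2⟩
        · have hjT := hT j ((Finset.mem_insert.1 hj).resolve_left hji)
          rw [Function.update_of_ne hji]
          exact ⟨hjT.1, fun z c h0 => hjT.2 z c (hzero z c h0).1⟩
  obtain ⟨ψ, h, -, -, -, hex', himp, hT⟩ := main Finset.univ
  refine ⟨fun z i => h i z, measurable_pi_lambda _ fun i => (hT i (Finset.mem_univ i)).1,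
    fun z => ?_⟩
  obtain ⟨c, hcS, h0⟩ := hex' z
  have : c = fun i => h i z := funext fun i => (hT i (Finset.mem_univ i)).2 z c h0
  subst this
  exact ⟨hcS, himp z _ h0⟩

end Selection

/-! ### Bounded Lipschitz functions and derivations -/

section BddLipschitz

variable {Z : Type*} [PseudoMetricSpace Z]

theorem IsBddLipschitz.const (a : ℝ) : IsBddLipschitz fun _ : Z => a :=
  ⟨⟨0, LipschitzWith.const a⟩, |a|, fun _ => le_rfl⟩

theorem IsBddLipschitz.add {f g : Z → ℝ} (hf : IsBddLipschitz f) (hg : IsBddLipschitz g) :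
    IsBddLipschitz fun y => f y + g y := by
  obtain ⟨⟨K, hK⟩, M, hM⟩ := hf
  obtain ⟨⟨L, hL⟩, P, hP⟩ := hg
  exact ⟨⟨K + L, hK.add hL⟩, M + P, fun y => (abs_add_le _ _).trans (add_le_add (hM y) (hP y))⟩

theorem IsBddLipschitz.mul {f g : Z → ℝ} (hf : IsBddLipschitz f) (hg : IsBddLipschitz g) :
    IsBddLipschitz fun y => f y * g y := by
  obtain ⟨⟨K, hK⟩, M, hM⟩ := hf
  obtain ⟨⟨L, hL⟩, P, hP⟩ := hg
  refine ⟨⟨Real.toNNReal (|M| * L + |P| * K), LipschitzWith.of_dist_le_mul fun y z => ?_⟩,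
    |M| * |P|, fun y => ?_⟩
  · rw [Real.coe_toNNReal _ (by positivity), Real.dist_eq]
    have h1 := hK.abs_sub_le y z
    have h2 := hL.abs_sub_le y z
    have h3 := (hM y).trans (le_abs_self M)
    have h4 := (hP z).trans (le_abs_self P)
    calc |f y * g y - f z * g z| = |f y * (g y - g z) + g z * (f y - f z)| := by ring_nf
      _ ≤ |f y| * |g y - g z| + |g z| * |f y - f z| := by
        rw [← abs_mul, ← abs_mul]
        exact abs_add_le _ _
      _ ≤ |M| * (L * dist y z) + |P| * (K * dist y z) := by gcongr
      _ = (|M| * L + |P| * K) * dist y z := by ring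
  · rw [abs_mul]
    exact mul_le_mul ((hM y).trans (le_abs_self M)) ((hP y).trans (le_abs_self P))
      (abs_nonneg _) (abs_nonneg _)

theorem IsBddLipschitz.const_mul {f : Z → ℝ} (hf : IsBddLipschitz f) (a : ℝ) :
    IsBddLipschitz fun y => a * f y :=
  (IsBddLipschitz.const a).mul hf

theorem IsBddLipschitz.sum {ι : Type*} {s : Finset ι} {f : ι → Z → ℝ}
    (hf : ∀ i, IsBddLipschitz (f i)) : IsBddLipschitz fun y => ∑ i ∈ s, f i y := by
  classical
  induction s using Finset.induction_on with
  | empty => simpa using IsBddLipschitz.const 0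
  | insert i s hi ih => simpa [Finset.sum_insert hi] using (hf i).add ih

theorem IsBddLipschitz.sub {f g : Z → ℝ} (hf : IsBddLipschitz f) (hg : IsBddLipschitz g) :
    IsBddLipschitz fun y => f y - g y := by
  simpa [sub_eq_add_neg] using hf.add (hg.const_mul (-1))

theorem IsBddLipschitz.of_mem_adjoin {G : Set (Z → ℝ)} (hG : ∀ g ∈ G, IsBddLipschitz g)
    {p : Z → ℝ} (hp : p ∈ Algebra.adjoin ℝ G) : IsBddLipschitz p := by
  induction hp using Algebra.adjoin_induction with
  | mem g hg => exact hG g hg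
  | algebraMap r => exact IsBddLipschitz.const r
  | add f g _ _ hf hg => exact hf.add hg
  | mul f g _ _ hf hg => exact hf.mul hg

theorem IsBddLipschitz.bigLip_eq_zero_iff {f : Z → ℝ} (hf : IsBddLipschitz f) (z : Z) :
    bigLip f z = 0 ↔ (fun y => f y - f z) =o[𝓝 z] fun y => dist y z := by
  obtain ⟨⟨K, hK⟩, -⟩ := hf
  exact hK.bigLip_eq_zero_iff z

end BddLipschitz

theorem measurable_matrix_det {Z ι : Type*} [MeasurableSpace Z] [Fintype ι] [DecidableEq ι]
    {M : Z → Matrix ι ι ℝ} (hM : ∀ i j, Measurable fun z => M z i j) :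
    Measurable fun z => (M z).det := by
  simp only [Matrix.det_apply']
  exact Finset.measurable_sum _ fun σ _ =>
    (Finset.measurable_prod _ fun i _ => hM _ _).const_mul _

section Derivation

variable {Z ι : Type*} [PseudoMetricSpace Z] [MeasurableSpace Z] {ν : Measure Z} [Fintype ι]

theorem MDerivation.D_const (d : MDerivation Z ν) (a : ℝ) : ∀ᵐ z ∂ν, d.D (fun _ => a) z = 0 := by
  have h1 := d.leibniz _ _ (IsBddLipschitz.const 1) (IsBddLipschitz.const 1)
  have h2 := d.linear a 0 _ _ (IsBddLipschitz.const 1) (IsBddLipschitz.const 1)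
  filter_upwards [h1, h2] with z hz1 hz2
  simp only [mul_one, one_mul, zero_mul, add_zero] at hz1 hz2
  rw [hz2, show d.D (fun _ => 1) z = 0 by linarith, mul_zero]

theorem MDerivation.D_add (d : MDerivation Z ν) {f g : Z → ℝ} (hf : IsBddLipschitz f)
    (hg : IsBddLipschitz g) : ∀ᵐ z ∂ν, d.D (fun y => f y + g y) z = d.D f z + d.D g z := by
  simpa using d.linear 1 1 f g hf hg

/-- A combination of derivations with measurable coefficients that vanishes on a set of
generators over `U` vanishes on all bounded Lipschitz functions over `U`. -/
theorem ae_sum_D_eq_zero_of_seqGenerates [SigmaFinite ν] (pd : ι → MDerivation Z ν)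
    {w : ι → Z → ℝ} (hw : ∀ j, Measurable (w j)) {U : Set Z} (hU : MeasurableSet U)
    {G : Set (Z → ℝ)} (hG : ∀ g ∈ G, IsBddLipschitz g) (hgen : SeqGenerates G)
    (h0 : ∀ g ∈ G, ∀ᵐ z ∂ν, z ∈ U → ∑ j, (pd j).D g z * w j z = 0)
    {f : Z → ℝ} (hf : IsBddLipschitz f) :
    ∀ᵐ z ∂ν, z ∈ U → ∑ j, (pd j).D f z * w j z = 0 := by
  have halg : ∀ p ∈ Algebra.adjoin ℝ G,
      ∀ᵐ z ∂ν, z ∈ U → ∑ j, (pd j).D p z * w j z = 0 := by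
    intro p hp
    induction hp using Algebra.adjoin_induction with
    | mem g hg => exact h0 g hg
    | algebraMap r =>
      filter_upwards [ae_all_iff.2 fun j => (pd j).D_const r] with z hz _
      exact Finset.sum_eq_zero fun j _ => mul_eq_zero_of_left (hz j) _
    | add f g hf hg ihf ihg =>
      filter_upwards [ihf, ihg, ae_all_iff.2 fun j => (pd j).D_add
        (IsBddLipschitz.of_mem_adjoin hG hf) (IsBddLipschitz.of_mem_adjoin hG hg)]
        with z h1 h2 h3 hz
      have : ∀ j, (pd j).D (f + g) z = (pd j).D f z + (pd j).D g z := h3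
      simp [this, add_mul, Finset.sum_add_distrib, h1 hz, h2 hz]
    | mul f g hf hg ihf ihg =>
      filter_upwards [ihf, ihg, ae_all_iff.2 fun j => (pd j).leibniz f g
        (IsBddLipschitz.of_mem_adjoin hG hf) (IsBddLipschitz.of_mem_adjoin hG hg)]
        with z h1 h2 h3 hz
      have : ∀ j, (pd j).D (f * g) z = f z * (pd j).D g z + g z * (pd j).D f z := h3
      simp [this, add_mul, Finset.sum_add_distrib, mul_assoc, ← Finset.mul_sum, h1 hz, h2 hz]
  obtain ⟨p, hp, hpB, hlim⟩ := hgen f hf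
  have hpL : ∀ k, IsBddLipschitz (p k) := fun k => IsBddLipschitz.of_mem_adjoin hG (hp k)
  let A : ℕ → Set Z := fun n => (U ∩ spanningSets ν n) ∩ ⋂ j, {z | |w j z| ≤ n}
  have hA : ∀ n, MeasurableSet (A n) := fun n =>
    (hU.inter (measurableSet_spanningSets ν n)).inter
      (MeasurableSet.iInter fun j => measurableSet_le (hw j).abs measurable_const)
  have hAfin : ∀ n, ν (A n) < ∞ := fun n =>
    (measure_mono (inter_subset_left.trans inter_subset_right)).trans_lt
      (measure_spanningSets_lt_top ν n)
  have hwint : ∀ n B, MeasurableSet B → ∀ j,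
      Integrable ((A n ∩ B).indicator (w j)) ν := by
    intro n B hB j
    rw [integrable_indicator_iff ((hA n).inter hB)]
    refine Measure.integrableOn_of_bounded (M := n)
      ((measure_mono inter_subset_left).trans_lt (hAfin n)).ne (hw j).aestronglyMeasurable ?_
    refine (ae_restrict_iff' ((hA n).inter hB)).2 (Eventually.of_forall fun z hz => ?_)
    exact mem_iInter.1 hz.1.2 j
  have hint : ∀ n B, MeasurableSet B → ∀ j q, IsBddLipschitz q →
      Integrable (fun z => (pd j).D q z * (A n ∩ B).indicator (w j) z) ν := fun n B hB j q hq =>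
    (hwint n B hB j).bdd_mul ((pd j).measurable_D q hq).aestronglyMeasurable
      ((pd j).bound q hq)
  have hind : ∀ n B q z, ∑ j, (pd j).D q z * (A n ∩ B).indicator (w j) z =
      (A n ∩ B).indicator (fun z => ∑ j, (pd j).D q z * w j z) z := by
    intro n B q z
    by_cases hz : z ∈ A n ∩ B <;> simp [hz]
  have hzero : ∀ n B, MeasurableSet B →
      ∫ z, ∑ j, (pd j).D f z * (A n ∩ B).indicator (w j) z ∂ν = 0 := by
    intro n B hB
    have hlim' : Tendsto (fun k => ∑ j, ∫ z, (pd j).D (p k) z * (A n ∩ B).indicator (w j) z ∂ν)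
        atTop (𝓝 (∑ j, ∫ z, (pd j).D f z * (A n ∩ B).indicator (w j) z ∂ν)) :=
      tendsto_finsetSum _ fun j _ => (pd j).weakStar p f hpL hf hpB hlim _ (hwint n B hB j)
    rw [integral_finsetSum _ fun j _ => hint n B hB j f hf]
    refine tendsto_nhds_unique hlim' (tendsto_const_nhds.congr fun k => ?_)
    rw [← integral_finsetSum _ fun j _ => hint n B hB j (p k) (hpL k)]
    refine (integral_eq_zero_of_ae ?_).symm
    filter_upwards [halg (p k) (hp k)] with z hz
    rw [hind, Pi.zero_apply]
    exact indicator_apply_eq_zero.2 fun hzA => hz hzA.1.1.1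
  have hae : ∀ n, ∀ᵐ z ∂ν, z ∈ A n → ∑ j, (pd j).D f z * w j z = 0 := by
    intro n
    have hi : Integrable ((A n).indicator fun z => ∑ j, (pd j).D f z * w j z) ν := by
      have := integrable_finsetSum Finset.univ fun j _ => hint n univ MeasurableSet.univ j f hf
      refine this.congr (Eventually.of_forall fun z => ?_)
      have := hind n univ f z
      rw [inter_univ] at this
      simpa using this
    have := hi.ae_eq_zero_of_forall_setIntegral_eq_zero fun B hB _ => by
      rw [← integral_indicator hB, indicator_indicator, inter_comm, ← hzero n B hB]
      exact integral_congr_ae (Eventually.of_forall fun z => (hind n B f z).symm)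
    filter_upwards [this] with z hz hzA
    rwa [indicator_of_mem hzA] at hz
  filter_upwards [ae_all_iff.2 hae] with z hz hzU
  obtain ⟨m, hm⟩ := mem_iUnion.1 ((iUnion_spanningSets ν).symm ▸ mem_univ z)
  obtain ⟨k, hk⟩ := exists_nat_ge (∑ j, |w j z|)
  refine hz (max m k) ⟨⟨hzU, monotone_spanningSets ν (le_max_left m k) hm⟩,
    mem_iInter.2 fun j => ?_⟩
  calc |w j z| ≤ ∑ j, |w j z| :=
        Finset.single_le_sum (f := fun j => |w j z|) (fun _ _ => abs_nonneg _) (Finset.mem_univ j)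
    _ ≤ k := hk
    _ ≤ (max m k : ℕ) := by exact_mod_cast le_max_right m k

variable [DecidableEq ι]

/-- If all Jacobian determinants of tuples of generators vanish over `U`, so do the Jacobian
determinants of all tuples of bounded Lipschitz functions. -/
theorem ae_det_D_eq_zero_of_seqGenerates [SigmaFinite ν] (pd : ι → MDerivation Z ν)
    {U : Set Z} (hU : MeasurableSet U)
    {G : Set (Z → ℝ)} (hG : ∀ g ∈ G, IsBddLipschitz g) (hgen : SeqGenerates G)
    (h0 : ∀ g : ι → Z → ℝ, (∀ i, g i ∈ G) →
      ∀ᵐ z ∂ν, z ∈ U → (Matrix.of fun i j => (pd j).D (g i) z).det = 0)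
    {f : ι → Z → ℝ} (hf : ∀ i, IsBddLipschitz (f i)) :
    ∀ᵐ z ∂ν, z ∈ U → (Matrix.of fun i j => (pd j).D (f i) z).det = 0 := by
  suffices main : ∀ (T : Finset ι) (f : ι → Z → ℝ), (∀ i, IsBddLipschitz (f i)) →
      (∀ i ∉ T, f i ∈ G) →
      ∀ᵐ z ∂ν, z ∈ U → (Matrix.of fun i j => (pd j).D (f i) z).det = 0 from
    main Finset.univ f hf fun i hi => absurd (Finset.mem_univ i) hi
  intro T
  induction T using Finset.induction_on with
  | empty => exact fun f _ hfG => h0 f fun i => hfG i (Finset.notMem_empty i)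
  | insert i T hi ih =>
    intro f hf hfG
    let M : Z → Matrix ι ι ℝ := fun z => Matrix.of fun i j => (pd j).D (f i) z
    have hrow : ∀ (q : Z → ℝ) z, ∑ j, (pd j).D q z * (M z).adjugate j i =
        (Matrix.of fun i' j => (pd j).D (Function.update f i q i') z).det := by
      intro q z
      have h1 : (Matrix.of fun i' j => (pd j).D (Function.update f i q i') z) =
          (M z).updateRow i fun j => (pd j).D q z := by
        ext i' j
        by_cases hii : i' = i
        · subst hii; simp
        · simp [hii, M]
      rw [h1, ← Matrix.cramer_transpose_apply, Matrix.cramer_eq_adjugate_mulVec,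
        ← Matrix.adjugate_transpose, Matrix.mulVec, dotProduct]
      exact Finset.sum_congr rfl fun j _ => mul_comm _ _
    have hMm : ∀ i j, Measurable fun z => M z i j := fun i j =>
      (pd j).measurable_D (f i) (hf i)
    have hw : ∀ j, Measurable fun z => (M z).adjugate j i := by
      intro j
      simp only [Matrix.adjugate_apply]
      refine measurable_matrix_det fun i' j' => ?_
      by_cases hii : i' = i
      · subst hii; simp
      · simpa [hii] using hMm i' j'
    have := ae_sum_D_eq_zero_of_seqGenerates pd hw hU hG hgen (fun g hg => by
      simp only [hrow]
      refine ih _ (fun i' => ?_) fun i' hi' => ?_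
      · by_cases hii : i' = i
        · subst hii; simpa using hG g hg
        · simpa [hii] using hf i'
      · by_cases hii : i' = i
        · subst hii; simpa using hg
        · simpa [hii] using hfG i' (by simp [hii, hi'])) (hf i)
    simpa only [hrow, Function.update_eq_self] using this

end Derivation

/-! ### Charts -/

theorem sigmaFinite_subMeasure {X : Type*} [MetricSpace X] [MeasurableSpace X] [BorelSpace X]
    {μ : Measure X} (hfin : ∀ (x : X) (r : ℝ), 0 < r → μ (ball x r) < ⊤) {s : Set X}
    (hs : MeasurableSet s) : SigmaFinite (subMeasure μ s) := by
  rcases s.eq_empty_or_nonempty with rfl | ⟨x, hx⟩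
  · rw [Measure.eq_zero_of_isEmpty (subMeasure μ (∅ : Set X))]
    infer_instance
  refine ⟨⟨⟨fun n : ℕ => Subtype.val ⁻¹' ball x (n + 1), fun _ => trivial, fun n => ?_, ?_⟩⟩⟩
  · rw [subMeasure, (MeasurableEmbedding.subtype_coe hs).comap_apply]
    exact (measure_mono (image_preimage_subset _ _)).trans_lt (hfin x _ (by positivity))
  · refine eq_univ_of_forall fun z => mem_iUnion.2 ?_
    obtain ⟨n, hn⟩ := exists_nat_gt (dist (z : X) x)
    exact ⟨n, mem_ball.2 (hn.trans (lt_add_one _))⟩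

/-- Uniqueness of the differential with respect to measurable coefficients implies pointwise
independence of the coordinate functions almost everywhere. -/
theorem ae_independent_of_unique {Z : Type*} {N : ℕ} [PseudoMetricSpace Z] [MeasurableSpace Z]
    [OpensMeasurableSpace Z] {ν : Measure Z} {xs : Fin N → Z → ℝ}
    (hxs : ∀ j, IsBddLipschitz (xs j))
    (hunique : ∀ b : Fin N → Z → ℝ, (∀ j, Measurable (b j)) →
      (∀ j, ∃ B : ℝ, ∀ᵐ z ∂ν, |b j z| ≤ B) →
      (∀ᵐ z ∂ν, bigLip (fun y => ∑ j, b j z * xs j y) z = 0) →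
      ∀ j, ∀ᵐ z ∂ν, b j z = 0) :
    ∀ᵐ z ∂ν, ∀ c : Fin N → ℝ, bigLip (fun y => ∑ j, c j * xs j y) z = 0 → c = 0 := by
  have hlin : ∀ c : Fin N → ℝ, IsBddLipschitz fun y => ∑ j, c j * xs j y := fun c =>
    IsBddLipschitz.sum fun j => (hxs j).const_mul (c j)
  let φ : Z → (Fin N → ℝ) → ℝ := fun z c => localSlope (fun y => ∑ j, c j * xs j y) z
  have hφ0 : ∀ z c, φ z c = 0 ↔ bigLip (fun y => ∑ j, c j * xs j y) z = 0 := by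
    intro z c
    obtain ⟨⟨K, hK⟩, -⟩ := hlin c
    rw [hK.bigLip_eq_zero_iff, ← hK.localSlope_eq_zero_iff]
  have hφn : ∀ z c, 0 ≤ φ z c := fun z c => localSlope_nonneg _ z
  have hφm : ∀ c, Measurable fun z => φ z c := by
    intro c
    obtain ⟨⟨K, hK⟩, -⟩ := hlin c
    exact hK.measurable_localSlope
  choose K hK using fun j => (hxs j).1
  have hφc : ∀ z, Continuous (φ z) := by
    intro z
    refine (LipschitzWith.of_le_add_mul (∑ j, K j) fun c c' => ?_).continuous
    obtain ⟨⟨L, hL⟩, -⟩ := hlin c'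
    refine hL.localSlope_le_add (by positivity) (fun y z => ?_) z
    calc |(∑ j, c j * xs j y - ∑ j, c j * xs j z) - (∑ j, c' j * xs j y - ∑ j, c' j * xs j z)|
        = |∑ j, (c j - c' j) * (xs j y - xs j z)| := by
          simp only [← Finset.sum_sub_distrib]
          congr 1
          exact Finset.sum_congr rfl fun j _ => by ring
      _ ≤ ∑ j, |c j - c' j| * |xs j y - xs j z| := by
          simp only [← abs_mul]
          exact Finset.abs_sum_le_sum_abs _ _
      _ ≤ ∑ j, dist c c' * (K j * dist y z) := by
          gcongr with j
          · exact dist_le_pi_dist c c' j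
          · exact (hK j).abs_sub_le y z
      _ = ↑(∑ j, K j) * dist c c' * dist y z := by
          push_cast
          rw [← Finset.mul_sum, ← Finset.sum_mul]
          ring
  let S : Set (Fin N → ℝ) := sphere 0 1
  have hS : IsCompact S := isCompact_sphere 0 1
  let E : Set Z := {z | ∃ c ∈ S, φ z c = 0}
  have hE : MeasurableSet E := measurableSet_exists_zero hφn hφm hφc hS
  have hsel : ∃ h : Z → Fin N → ℝ, Measurable h ∧ ∀ z ∈ E, h z ∈ S ∧ φ z (h z) = 0 := by
    rcases E.eq_empty_or_nonempty with hemp | ⟨z₀, c₀, hc₀, -⟩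
    · exact ⟨fun _ => 0, measurable_const, by simp [hemp]⟩
    classical
    obtain ⟨h, hm, hh⟩ := exists_measurable_zero (φ := fun z c => if z ∈ E then φ z c else 0)
      (S := S) (fun z c => by split_ifs; exacts [hφn z c, le_rfl])
      (fun c => Measurable.ite hE (hφm c) measurable_const)
      (fun z => by split_ifs; exacts [hφc z, continuous_const]) hS
      (fun z => by
        by_cases hz : z ∈ E
        · obtain ⟨c, hcS, hc⟩ := hz
          exact ⟨c, hcS, by simp [hc]⟩
        · exact ⟨c₀, hc₀, by simp [hz]⟩)
    exact ⟨h, hm, fun z hz => by simpa [hz] using hh z⟩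
  obtain ⟨h, hhm, hh⟩ := hsel
  have hb := hunique (fun j => E.indicator fun z => h z j)
    (fun j => ((measurable_pi_apply j).comp hhm).indicator hE)
    (fun j => ⟨1, Eventually.of_forall fun z => by
      by_cases hz : z ∈ E
      · rw [indicator_of_mem hz]
        have h1 := norm_le_pi_norm (h z) j
        rwa [mem_sphere_zero_iff_norm.1 (hh z hz).1] at h1
      · simp [hz]⟩)
    (Eventually.of_forall fun z => by
      by_cases hz : z ∈ E
      · simpa [hz] using (hφ0 z (h z)).1 (hh z hz).2
      · have := (IsBddLipschitz.const (Z := Z) 0).bigLip_eq_zero_iff z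
        simpa [hz] using this)
  filter_upwards [ae_all_iff.2 hb] with z hz c hc
  by_contra hne
  have hzE : z ∈ E := by
    refine ⟨‖c‖⁻¹ • c, mem_sphere_zero_iff_norm.2 (norm_smul_inv_norm hne), (hφ0 z _).2 ?_⟩
    rw [(hlin _).bigLip_eq_zero_iff] at hc ⊢
    simpa [mul_assoc, ← Finset.mul_sum, ← mul_sub] using hc.const_mul_left ‖c‖⁻¹
  have h0 : h z = 0 := funext fun j => by simpa [hzE] using hz j
  have h1 := mem_sphere_zero_iff_norm.1 (hh z hzE).1
  simp [h0] at h1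

theorem stmt_18 {X : Type*} [MetricSpace X] [CompleteSpace X]
    [MeasurableSpace X] [BorelSpace X] (μ : Measure X) (hμ : μ ≠ 0)
    (hpos : ∀ (x : X) (r : ℝ), 0 < r → 0 < μ (ball x r))
    (hfin : ∀ (x : X) (r : ℝ), 0 < r → μ (ball x r) < ⊤)
    (CD : ℝ≥0∞) (hCD : 1 ≤ CD)
    (hdoub : ∀ (x : X) (r : ℝ), 0 < r → μ (ball x (2 * r)) ≤ CD * μ (ball x r))
    (Xα : Set X) (hXα : MeasurableSet Xα) (hXαpos : 0 < μ Xα)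
    {N : ℕ} (xs : Fin N → Xα → ℝ) (hxs : ∀ j, IsBddLipschitz (xs j))
    (pd : Fin N → MDerivation Xα (subMeasure μ Xα))
    (hchart : ∀ f : Xα → ℝ, IsBddLipschitz f → ∀ᵐ z ∂(subMeasure μ Xα),
      bigLip (fun y => f y - ∑ j, (pd j).D f z * xs j y) z = 0)
    (hunique : ∀ f : Xα → ℝ, IsBddLipschitz f → ∀ b : Fin N → Xα → ℝ,
      (∀ j, Measurable (b j)) → (∀ j, ∃ B : ℝ, ∀ᵐ z ∂(subMeasure μ Xα), |b j z| ≤ B) →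
      (∀ᵐ z ∂(subMeasure μ Xα), bigLip (fun y => f y - ∑ j, b j z * xs j y) z = 0) →
      ∀ j, ∀ᵐ z ∂(subMeasure μ Xα), b j z = (pd j).D f z)
    (G : Set (Xα → ℝ)) (hG : ∀ g ∈ G, IsBddLipschitz g) (hgen : SeqGenerates G) :
    ∀ U : Set Xα, MeasurableSet U → 0 < subMeasure μ Xα U →
      ∃ V : Set Xα, V ⊆ U ∧ MeasurableSet V ∧ 0 < subMeasure μ Xα V ∧
      ∃ g' : Fin N → Xα → ℝ, (∀ j, g' j ∈ G) ∧
        ∀ᵐ z ∂(subMeasure μ Xα).restrict V, ∀ c : Fin N → ℝ,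
          bigLip (fun y => ∑ j, c j * g' j y) z = 0 → ∀ j, c j = 0 := by
  intro U hU hUpos
  have := sigmaFinite_subMeasure hfin hXα
  have hconst0 : ∀ z, bigLip (fun _ : Xα => (0 : ℝ)) z = 0 := fun z =>
    ((IsBddLipschitz.const 0).bigLip_eq_zero_iff z).2 (by simp)
  have hind : ∀ᵐ z ∂(subMeasure μ Xα), ∀ c : Fin N → ℝ,
      bigLip (fun y => ∑ j, c j * xs j y) z = 0 → c = 0 := by
    refine ae_independent_of_unique hxs fun b hbm hbB hb j => ?_
    have h1 := hunique (fun _ => 0) (IsBddLipschitz.const 0) (fun j z => -b j z)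
      (fun j => (hbm j).neg) (fun j => by simpa using hbB j) (by simpa using hb) j
    filter_upwards [h1, (pd j).D_const 0] with z hz1 hz2
    linarith
  have hcoord : ∀ i j, ∀ᵐ z ∂(subMeasure μ Xα),
      (1 : Matrix (Fin N) (Fin N) ℝ) i j = (pd j).D (xs i) z := by
    intro i
    refine hunique (xs i) (hxs i) (fun j _ => (1 : Matrix (Fin N) (Fin N) ℝ) i j)
      (fun j => measurable_const) (fun j => ⟨_, Eventually.of_forall fun _ => le_rfl⟩)
      (Eventually.of_forall fun z => ?_)
    simpa [Matrix.one_apply] using hconst0 z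
  obtain ⟨g, hgG, hg⟩ : ∃ g : Fin N → Xα → ℝ, (∀ i, g i ∈ G) ∧
      ¬ ∀ᵐ z ∂(subMeasure μ Xα), z ∈ U → (Matrix.of fun i j => (pd j).D (g i) z).det = 0 := by
    by_contra! hcon
    have hdet := ae_det_D_eq_zero_of_seqGenerates pd hU hG hgen hcon hxs
    refine hUpos.ne' (measure_eq_zero_iff_ae_notMem.2 ?_)
    filter_upwards [hdet, ae_all_iff.2 fun i => ae_all_iff.2 (hcoord i)] with z h1 h2 hz
    have : (Matrix.of fun i j => (pd j).D (xs i) z) = 1 := by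
      ext i j
      exact (h2 i j).symm
    simpa [this] using h1 hz
  let A : Xα → Matrix (Fin N) (Fin N) ℝ := fun z => Matrix.of fun i j => (pd j).D (g i) z
  have hAm : Measurable fun z => (A z).det :=
    measurable_matrix_det fun i j => (pd j).measurable_D (g i) (hG _ (hgG i))
  have hVm : MeasurableSet (U ∩ {z | (A z).det ≠ 0}) :=
    hU.inter (hAm (measurableSet_singleton (0 : ℝ)).compl)
  refine ⟨U ∩ {z | (A z).det ≠ 0}, inter_subset_left, hVm, pos_iff_ne_zero.2 fun h0 => hg ?_,
    g, hgG, ?_⟩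
  · filter_upwards [measure_eq_zero_iff_ae_notMem.1 h0] with z hz hzU
    by_contra hne
    exact hz ⟨hzU, hne⟩
  rw [ae_restrict_iff' hVm]
  filter_upwards [hind, ae_all_iff.2 fun i => hchart (g i) (hG _ (hgG i))] with z hz hch hzV c hc
  suffices hvec : Matrix.vecMul c (A z) = 0 from
    congrFun (Matrix.eq_zero_of_vecMul_eq_zero hzV.2 hvec)
  have hlin : ∀ a : Fin N → ℝ, IsBddLipschitz fun y => ∑ j, a j * xs j y := fun a =>
    IsBddLipschitz.sum fun j => (hxs j).const_mul (a j)
  refine hz _ ((hlin _).bigLip_eq_zero_iff z |>.2 ?_)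
  rw [(IsBddLipschitz.sum fun j => (hG _ (hgG j)).const_mul (c j)).bigLip_eq_zero_iff] at hc
  have hsum := Asymptotics.IsLittleO.sum (s := Finset.univ) fun i (_ : i ∈ Finset.univ) =>
    ((((hG _ (hgG i)).sub (hlin fun j => (pd j).D (g i) z)).bigLip_eq_zero_iff z).1
      (hch i)).const_mul_left (c i)
  refine (hc.sub hsum).congr_left fun y => ?_
  have hswap : ∀ y, ∑ j, Matrix.vecMul c (A z) j * xs j y =
      ∑ i, c i * ∑ j, (pd j).D (g i) z * xs j y := by
    intro y
    simp only [Matrix.vecMul, dotProduct, Finset.sum_mul, Finset.mul_sum]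
    rw [Finset.sum_comm]
    exact Finset.sum_congr rfl fun i _ => Finset.sum_congr rfl fun j _ => by
      simp [A, mul_assoc]
  rw [hswap, hswap]
  simp only [Finset.sum_apply, ← Finset.sum_sub_distrib]
  exact Finset.sum_congr rfl fun i _ => by ring
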